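/- Assume c ≥ 48, center separation, centers ν_1,…,ν_k ∈ ℝ^d with ‖μ_r − ν_r‖ ≤ 6·Δ_r for every r, and let Â be an n×d real matrix with ‖Â − C‖_F² ≤ 8·n_r·Δ_r² for every r. Let z : {1,…,n} → {1,…,k} be any assignment with ‖Â_i − ν_{z(i)}‖ ≤ ‖Â_i − ν_s‖ for all i and all s. Then for every cluster index r₀, the number of indices i with z(i) = r₀ and i ∉ T_{r₀} is at most (128/c²)·n_{r₀}. -/

import Mathlib

open Finset
open scoped Classical

noncomputable section

/-- Spectral (ℓ₂ operator) norm of a real matrix. -/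
def specNorm {m p : Type*} [Fintype m] [Fintype p] [DecidableEq p] (M : Matrix m p ℝ) : ℝ :=
  ‖LinearMap.toContinuousLinearMap (Matrix.toEuclideanLin M)‖

/-- Frobenius norm of a real matrix. -/
def frobNorm {m p : Type*} [Fintype m] [Fintype p] (M : Matrix m p ℝ) : ℝ :=
  Real.sqrt (∑ i, ∑ j, (M i j) ^ 2)

variable {n d k : ℕ}

/-- The i-th row of a matrix, viewed as a point of Euclidean space. -/
def row (M : Matrix (Fin n) (Fin d) ℝ) (i : Fin n) : EuclideanSpace ℝ (Fin d) :=
  (WithLp.equiv 2 (Fin d → ℝ)).symm (M i)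

/-- The set of indices assigned to cluster `r` by the clustering `τ`. -/
def cluster (τ : Fin n → Fin k) (r : Fin k) : Finset (Fin n) :=
  Finset.univ.filter fun i => τ i = r

/-- The size `n_r` of cluster `r`. -/
def clusterSize (τ : Fin n → Fin k) (r : Fin k) : ℕ := (cluster τ r).card

/-- The mean of the rows of `M` indexed by `S`. -/
def meanOf (M : Matrix (Fin n) (Fin d) ℝ) (S : Finset (Fin n)) : EuclideanSpace ℝ (Fin d) :=
  (S.card : ℝ)⁻¹ • ∑ i ∈ S, row M i

/-- The mean `μ_r` of cluster `r`. -/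
def mu (A : Matrix (Fin n) (Fin d) ℝ) (τ : Fin n → Fin k) (r : Fin k) :
    EuclideanSpace ℝ (Fin d) :=
  meanOf A (cluster τ r)

/-- The matrix `C` whose i-th row is the mean of the cluster containing `i`. -/
def centerMatrix (A : Matrix (Fin n) (Fin d) ℝ) (τ : Fin n → Fin k) :
    Matrix (Fin n) (Fin d) ℝ :=
  fun i j => mu A τ (τ i) j

/-- `Δ_r = (1/√n_r) · min {√k·‖A−C‖, ‖A−C‖_F}`. -/
def Delta (A : Matrix (Fin n) (Fin d) ℝ) (τ : Fin n → Fin k) (r : Fin k) : ℝ :=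
  (Real.sqrt (clusterSize τ r))⁻¹ *
    min (Real.sqrt k * specNorm (A - centerMatrix A τ)) (frobNorm (A - centerMatrix A τ))

end

lemma frobNorm_sq {m p : Type*} [Fintype m] [Fintype p] (M : Matrix m p ℝ) :
    frobNorm M ^ 2 = ∑ i, ∑ j, M i j ^ 2 :=
  Real.sq_sqrt (Finset.sum_nonneg fun _ _ => Finset.sum_nonneg fun _ _ => sq_nonneg _)

lemma frobNorm_pos {m p : Type*} [Fintype m] [Fintype p] {M : Matrix m p ℝ} (hM : M ≠ 0) :
    0 < frobNorm M := by
  obtain ⟨i, hi⟩ := Function.ne_iff.mp hM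
  obtain ⟨j, hj⟩ := Function.ne_iff.mp hi
  have hj_pos : 0 < M i j ^ 2 := sq_pos_of_ne_zero hj
  refine Real.sqrt_pos.mpr (Finset.sum_pos'
    (fun _ _ => Finset.sum_nonneg fun _ _ => sq_nonneg _) ⟨i, Finset.mem_univ i, ?_⟩)
  exact Finset.sum_pos' (fun _ _ => sq_nonneg _) ⟨j, Finset.mem_univ j, hj_pos⟩

lemma specNorm_pos {m p : Type*} [Fintype m] [Fintype p] [DecidableEq p] {M : Matrix m p ℝ}
    (hM : M ≠ 0) : 0 < specNorm M := by
  unfold specNorm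
  rw [norm_pos_iff]
  simpa using hM

lemma Delta_pos {n d k : ℕ} {A : Matrix (Fin n) (Fin d) ℝ} {τ : Fin n → Fin k} {r : Fin k}
    (hr : (cluster τ r).Nonempty) (hAC : A ≠ centerMatrix A τ) : 0 < Delta A τ r := by
  have hM : A - centerMatrix A τ ≠ 0 := sub_ne_zero.mpr hAC
  have hk : (0 : ℝ) < k := Nat.cast_pos.mpr r.pos
  have hn : (0 : ℝ) < clusterSize τ r := Nat.cast_pos.mpr hr.card_pos
  exact mul_pos (inv_pos.mpr (Real.sqrt_pos.mpr hn))
    (lt_min (mul_pos (Real.sqrt_pos.mpr hk) (specNorm_pos hM)) (frobNorm_pos hM))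

lemma frobNorm_sub_centerMatrix_sq {n d k : ℕ} (A B : Matrix (Fin n) (Fin d) ℝ)
    (τ : Fin n → Fin k) :
    frobNorm (B - centerMatrix A τ) ^ 2 = ∑ i, ‖row B i - mu A τ (τ i)‖ ^ 2 := by
  simp [frobNorm_sq, EuclideanSpace.norm_sq_eq, row, centerMatrix]

/-- A point at least as close to `v` as to `v'` is far from any `u'` near `v'`, provided `v` is
near some `u` that is far from `u'`. -/
lemma norm_sub_sub_add_le_two_mul {E : Type*} [SeminormedAddCommGroup E] {x u u' v v' : E}
    (h : ‖x - v‖ ≤ ‖x - v'‖) : ‖u - u'‖ - (‖u - v‖ + ‖u' - v'‖) ≤ 2 * ‖x - u'‖ := by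
  have h₁ := norm_sub_le_norm_sub_add_norm_sub u v u'
  have h₂ := norm_sub_le_norm_sub_add_norm_sub v x u'
  have h₃ := norm_sub_le_norm_sub_add_norm_sub x u' v'
  rw [norm_sub_rev v x] at h₂
  linarith

/-- under center separation (with `c ≥ 48`), matched centers `ν_r` and a nearest-center
assignment `z` on the rows of `Â`, each output cluster `Z_{r₀}` contains at most `(128/c²)·n_{r₀}`
points from other target clusters. -/
theorem stmt5 {n d k : ℕ} (hk : 2 ≤ k) (A Ahat : Matrix (Fin n) (Fin d) ℝ)
    (τ : Fin n → Fin k) (hfib : ∀ r, (cluster τ r).Nonempty)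
    (c : ℝ) (hc : 48 ≤ c)
    (hAC : A ≠ centerMatrix A τ)
    (hsep : ∀ r s, r ≠ s → c * (Delta A τ r + Delta A τ s) ≤ ‖mu A τ r - mu A τ s‖)
    (ν : Fin k → EuclideanSpace ℝ (Fin d))
    (hν : ∀ r, ‖mu A τ r - ν r‖ ≤ 6 * Delta A τ r)
    (hAhat : ∀ r, frobNorm (Ahat - centerMatrix A τ) ^ 2 ≤
      8 * clusterSize τ r * Delta A τ r ^ 2)
    (z : Fin n → Fin k) (hz : ∀ i s, ‖row Ahat i - ν (z i)‖ ≤ ‖row Ahat i - ν s‖)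
    (r₀ : Fin k) :
    ((Finset.univ.filter fun i => z i = r₀ ∧ τ i ≠ r₀).card : ℝ) ≤
      128 / c ^ 2 * clusterSize τ r₀ := by
  have hΔ : ∀ r, 0 < Delta A τ r := fun r => Delta_pos (hfib r) hAC
  set S := Finset.univ.filter fun i => z i = r₀ ∧ τ i ≠ r₀
  have hfar : ∀ i ∈ S, (c / 4 * Delta A τ r₀) ^ 2 ≤ ‖row Ahat i - mu A τ (τ i)‖ ^ 2 := by
    intro i hi
    obtain ⟨hzi, hτi⟩ := (Finset.mem_filter.mp hi).2
    have hnear := norm_sub_sub_add_le_two_mul (u := mu A τ r₀) (u' := mu A τ (τ i))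
      (hzi ▸ hz i (τ i))
    have hsep' := hsep r₀ (τ i) (Ne.symm hτi)
    have hr := hν r₀
    have hs := hν (τ i)
    have hr_pos := hΔ r₀
    have hs_pos := hΔ (τ i)
    have hc_nonneg : 0 ≤ c := by linarith
    refine pow_le_pow_left₀ (by positivity) ?_ 2
    nlinarith [mul_nonneg (sub_nonneg.mpr hc) hr_pos.le, mul_nonneg (sub_nonneg.mpr hc) hs_pos.le]
  have hsum : S.card * (c / 4 * Delta A τ r₀) ^ 2 ≤
      8 * clusterSize τ r₀ * Delta A τ r₀ ^ 2 := by
    refine le_trans ?_ (hAhat r₀)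
    rw [frobNorm_sub_centerMatrix_sq, ← nsmul_eq_mul]
    exact (Finset.card_nsmul_le_sum S _ _ hfar).trans
      (Finset.sum_le_sum_of_subset_of_nonneg (Finset.subset_univ S) fun _ _ _ => sq_nonneg _)
  have hc_pos : 0 < c := by linarith
  have hbound : S.card * c ^ 2 / 16 ≤ 8 * clusterSize τ r₀ :=
    le_of_mul_le_mul_right (by linarith) (pow_pos (hΔ r₀) 2)
  rw [div_mul_eq_mul_div, le_div_iff₀ (pow_pos hc_pos 2)]
  linarith
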